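/- arXiv:1304.3886 — 2 statements merged into one kernel-verified Lean document; each statement's English description precedes it below -/
import Mathlib

section
/- (HCRB for the SSNM, full-sparsity case.) Consider the SSNM with S < N. Let k ∈ {1,…,N} and x₀ ∈ X_S with |supp(x₀)| = S and k ∉ supp(x₀). Let ĝ : ℝ^N → ℝ be Borel measurable with ∫ ĝ² dP_{x₀} < ∞, and suppose ĝ is an unbiased estimator of x_k on X_S, i.e., ĝ is P_x-integrable with ∫ ĝ dP_x = x_k for every x ∈ X_S. Then v(ĝ; x₀) ≥ σ² · ((N − S − 1)/(N − S)) · exp(−ξ₀²/σ²), where ξ₀² = min_{l ∈ supp(x₀)} (x₀)_l² is the squared magnitude of the smallest (in magnitude) nonzero entry of x₀. -/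
open MeasureTheory ProbabilityTheory

/-- The distribution `P_x` of `y = x + n` where `n` has i.i.d. `N(0,σ²)` entries
(sparse signal in noise model, SSNM). -/
noncomputable def ssnmP {N : ℕ} (σ : ℝ) (x : Fin N → ℝ) : Measure (Fin N → ℝ) :=
  Measure.map (fun n => x + n)
    (Measure.pi fun _ : Fin N => gaussianReal 0 ((σ ^ 2).toNNReal))

/-- The set `X_S` of `S`-sparse parameter vectors. -/
def sparseSet (N S : ℕ) : Set (Fin N → ℝ) := {x | (Function.support x).ncard ≤ S}

/-- Mean function `γ_ĝ(x) = ∫ ĝ dP_x` of an estimator. -/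
noncomputable def ssnmMean {N : ℕ} (σ : ℝ) (g : (Fin N → ℝ) → ℝ) (x : Fin N → ℝ) : ℝ :=
  ∫ y, g y ∂ ssnmP σ x

/-- Variance `v(ĝ;x) = ∫ (ĝ(y) − γ_ĝ(x))² dP_x(y)` of an estimator. -/
noncomputable def ssnmVar {N : ℕ} (σ : ℝ) (g : (Fin N → ℝ) → ℝ) (x : Fin N → ℝ) : ℝ :=
  ∫ y, (g y - ssnmMean σ g x) ^ 2 ∂ ssnmP σ x

section WithDensity

variable {ι : Type*} [Fintype ι] {X : ι → Type*} [∀ i, MeasurableSpace (X i)]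

/-- A finite product of measures with densities is the product measure with the product density. -/
theorem pi_withDensity_ofReal (μ : ∀ i, Measure (X i)) [∀ i, SigmaFinite (μ i)]
    (f : ∀ i, X i → ℝ) (hf0 : ∀ i y, 0 ≤ f i y) (hf : ∀ i, Integrable (f i) (μ i)) :
    Measure.pi (fun i => (μ i).withDensity fun y => ENNReal.ofReal (f i y)) =
      (Measure.pi μ).withDensity fun y => ENNReal.ofReal (∏ i, f i (y i)) := by
  refine Measure.pi_eq fun s hs => ?_
  rw [withDensity_apply _ (MeasurableSet.univ_pi hs), Measure.restrict_pi_pi,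
    ← ofReal_integral_eq_lintegral_ofReal (f := fun y : ∀ i, X i => ∏ i, f i (y i))
      (Integrable.fintype_prod_dep (f := f) fun i => (hf i).restrict)
      (.of_forall fun y => Finset.prod_nonneg fun i _ => hf0 i _),
    integral_fintype_prod_eq_prod f,
    ENNReal.ofReal_prod_of_nonneg fun i _ => integral_nonneg (hf0 i)]
  refine Finset.prod_congr rfl fun i _ => ?_
  rw [withDensity_apply _ (hs i),
    ofReal_integral_eq_lintegral_ofReal (hf i).restrict (.of_forall (hf0 i))]

end WithDensity

open scoped NNReal in
/-- The density of a translated Gaussian with respect to the original one. -/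
theorem gaussianReal_add_eq_withDensity (m a : ℝ) {v : ℝ≥0} (hv : v ≠ 0) :
    gaussianReal (m + a) v = (gaussianReal m v).withDensity
      fun y => ENNReal.ofReal (Real.exp (a * (y - m) / v - a ^ 2 / (2 * v))) := by
  rw [gaussianReal_of_var_ne_zero _ hv, gaussianReal_of_var_ne_zero _ hv,
    ← withDensity_mul _ (measurable_gaussianPDF m v) (by fun_prop)]
  congr 1
  ext y
  have hv' : (v : ℝ) ≠ 0 := by exact_mod_cast hv
  rw [Pi.mul_apply, gaussianPDF, gaussianPDF,
    ← ENNReal.ofReal_mul (gaussianPDFReal_nonneg _ _ _), gaussianPDFReal, gaussianPDFReal,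
    mul_assoc _ (Real.exp _) (Real.exp _), ← Real.exp_add]
  congr 3
  field_simp
  ring

/-- The likelihood ratio `dP_{x+d} / dP_x`. -/
noncomputable def ssnmLR {N : ℕ} (σ : ℝ) (x d y : Fin N → ℝ) : ℝ :=
  Real.exp (∑ i, (d i * (y i - x i) / σ ^ 2 - d i ^ 2 / (2 * σ ^ 2)))

section Likelihood

variable {N : ℕ} {σ : ℝ}

theorem ssnmP_eq_pi (x : Fin N → ℝ) :
    ssnmP σ x = Measure.pi fun i => gaussianReal (x i) ((σ ^ 2).toNNReal) := by
  have h := Measure.pi_map_pi (μ := fun _ : Fin N => gaussianReal 0 ((σ ^ 2).toNNReal))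
    (f := fun i n => x i + n) (fun i => by fun_prop)
  simp_rw [gaussianReal_map_const_add, zero_add] at h
  exact h

instance (x : Fin N → ℝ) : IsProbabilityMeasure (ssnmP σ x) := by
  rw [ssnmP_eq_pi]
  infer_instance

theorem measurable_ssnmLR (x d : Fin N → ℝ) : Measurable (ssnmLR σ x d) := by
  unfold ssnmLR
  fun_prop

theorem ssnmLR_nonneg (x d y : Fin N → ℝ) : 0 ≤ ssnmLR σ x d y := (Real.exp_pos _).le

theorem ssnmP_add (hσ : 0 < σ) (x d : Fin N → ℝ) :
    ssnmP σ (x + d) = (ssnmP σ x).withDensity fun y => ENNReal.ofReal (ssnmLR σ x d y) := by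
  have hv : (σ ^ 2).toNNReal ≠ 0 := by
    rw [Ne, Real.toNNReal_eq_zero, not_le]
    positivity
  have hcoe : (((σ ^ 2).toNNReal : NNReal) : ℝ) = σ ^ 2 := Real.coe_toNNReal _ (sq_nonneg σ)
  have hden := fun i => gaussianReal_add_eq_withDensity (x i) (d i) hv
  rw [hcoe] at hden
  have hint : ∀ i, Integrable
      (fun y => Real.exp (d i * (y - x i) / σ ^ 2 - d i ^ 2 / (2 * σ ^ 2)))
      (gaussianReal (x i) ((σ ^ 2).toNNReal)) := fun i => by
    have h := (integrable_exp_mul_gaussianReal (μ := x i) (v := (σ ^ 2).toNNReal)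
      (d i / σ ^ 2)).mul_const (Real.exp (- (d i * x i / σ ^ 2) - d i ^ 2 / (2 * σ ^ 2)))
    refine h.congr (.of_forall fun y => ?_)
    dsimp only
    rw [← Real.exp_add]
    congr 1
    ring
  rw [ssnmP_eq_pi, ssnmP_eq_pi]
  simp_rw [Pi.add_apply, hden]
  rw [pi_withDensity_ofReal _
    (fun i y => Real.exp (d i * (y - x i) / σ ^ 2 - d i ^ 2 / (2 * σ ^ 2)))
    (fun i y => (Real.exp_pos _).le) hint]
  simp_rw [ssnmLR, Real.exp_sum]

theorem integrable_ssnmP_add_iff (hσ : 0 < σ) (x d : Fin N → ℝ) (g : (Fin N → ℝ) → ℝ) :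
    Integrable g (ssnmP σ (x + d)) ↔
      Integrable (fun y => ssnmLR σ x d y * g y) (ssnmP σ x) := by
  rw [ssnmP_add hσ, integrable_withDensity_iff_integrable_smul'
    (measurable_ssnmLR x d).ennreal_ofReal (.of_forall fun _ => ENNReal.ofReal_lt_top)]
  simp only [ENNReal.toReal_ofReal (ssnmLR_nonneg x d _), smul_eq_mul]

theorem integral_ssnmP_add (hσ : 0 < σ) (x d : Fin N → ℝ) (g : (Fin N → ℝ) → ℝ) :
    ∫ y, g y ∂ssnmP σ (x + d) = ∫ y, ssnmLR σ x d y * g y ∂ssnmP σ x := by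
  rw [ssnmP_add hσ, integral_withDensity_eq_integral_toReal_smul
    (measurable_ssnmLR x d).ennreal_ofReal (.of_forall fun _ => ENNReal.ofReal_lt_top)]
  simp only [ENNReal.toReal_ofReal (ssnmLR_nonneg x d _), smul_eq_mul]

theorem integrable_ssnmLR (hσ : 0 < σ) (x d : Fin N → ℝ) :
    Integrable (ssnmLR σ x d) (ssnmP σ x) := by
  simpa using (integrable_ssnmP_add_iff hσ x d fun _ => 1).1 (integrable_const 1)

theorem integral_ssnmLR (hσ : 0 < σ) (x d : Fin N → ℝ) :
    ∫ y, ssnmLR σ x d y ∂ssnmP σ x = 1 := by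
  simpa using (integral_ssnmP_add hσ x d fun _ => 1).symm

theorem ssnmLR_mul (x d e y : Fin N → ℝ) :
    ssnmLR σ x d y * ssnmLR σ x e y =
      Real.exp ((∑ i, d i * e i) / σ ^ 2) * ssnmLR σ x (d + e) y := by
  rw [ssnmLR, ssnmLR, ssnmLR, ← Real.exp_add, ← Real.exp_add, Finset.sum_div,
    ← Finset.sum_add_distrib, ← Finset.sum_add_distrib]
  congr 1
  refine Finset.sum_congr rfl fun i _ => ?_
  simp only [Pi.add_apply]
  ring

theorem integrable_ssnmLR_mul (hσ : 0 < σ) (x d e : Fin N → ℝ) :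
    Integrable (fun y => ssnmLR σ x d y * ssnmLR σ x e y) (ssnmP σ x) := by
  simp_rw [ssnmLR_mul]
  exact (integrable_ssnmLR hσ x _).const_mul _

theorem integral_ssnmLR_mul (hσ : 0 < σ) (x d e : Fin N → ℝ) :
    ∫ y, ssnmLR σ x d y * ssnmLR σ x e y ∂ssnmP σ x = Real.exp ((∑ i, d i * e i) / σ ^ 2) := by
  simp_rw [ssnmLR_mul]
  rw [integral_const_mul, integral_ssnmLR hσ, mul_one]

/-- Cauchy-Schwarz bound on the difference of the means at `x + d` and `x + e` in terms of the
variance at `x`. -/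
theorem sq_sub_mean_le (hσ : 0 < σ) (x d e : Fin N → ℝ) {g : (Fin N → ℝ) → ℝ}
    (hsq : Integrable (fun y => g y ^ 2) (ssnmP σ x)) (h0 : Integrable g (ssnmP σ x))
    (hd : Integrable g (ssnmP σ (x + d))) (he : Integrable g (ssnmP σ (x + e))) :
    (ssnmMean σ g (x + d) - ssnmMean σ g (x + e)) ^ 2 ≤
      ssnmVar σ g x * (Real.exp ((∑ i, d i * d i) / σ ^ 2)
        - 2 * Real.exp ((∑ i, d i * e i) / σ ^ 2) + Real.exp ((∑ i, e i * e i) / σ ^ 2)) := by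
  set μ := ssnmP σ x
  set m := ssnmMean σ g x
  set D : (Fin N → ℝ) → ℝ := fun y => ssnmLR σ x d y - ssnmLR σ x e y with hD
  have iDD := integrable_ssnmLR_mul hσ x d d
  have iDE := integrable_ssnmLR_mul hσ x d e
  have iEE := integrable_ssnmLR_mul hσ x e e
  have eD2 : (fun y => D y ^ 2) = fun y => ssnmLR σ x d y * ssnmLR σ x d y
      - 2 * (ssnmLR σ x d y * ssnmLR σ x e y) + ssnmLR σ x e y * ssnmLR σ x e y := by
    ext y
    simp only [hD]
    ring
  have iS : Integrable (fun y => ssnmLR σ x d y * ssnmLR σ x d y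
      - 2 * (ssnmLR σ x d y * ssnmLR σ x e y)) μ := iDD.sub (iDE.const_mul 2)
  have iD2 : Integrable (fun y => D y ^ 2) μ := by
    rw [eD2]
    exact iS.add iEE
  have vD2 : ∫ y, D y ^ 2 ∂μ = Real.exp ((∑ i, d i * d i) / σ ^ 2)
        - 2 * Real.exp ((∑ i, d i * e i) / σ ^ 2) + Real.exp ((∑ i, e i * e i) / σ ^ 2) := by
    rw [eD2, integral_add iS iEE, integral_sub iDD (iDE.const_mul 2),
      integral_const_mul, integral_ssnmLR_mul hσ, integral_ssnmLR_mul hσ, integral_ssnmLR_mul hσ]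
  have gd := (integrable_ssnmP_add_iff hσ x d g).1 hd
  have ge := (integrable_ssnmP_add_iff hσ x e g).1 he
  have ld := integrable_ssnmLR hσ x d
  have le := integrable_ssnmLR hσ x e
  have iG : Integrable (fun y => ssnmLR σ x d y * g y - ssnmLR σ x e y * g y) μ := gd.sub ge
  have iL : Integrable (fun y => m * (ssnmLR σ x d y - ssnmLR σ x e y)) μ :=
    (ld.sub le).const_mul m
  have eX : (fun y => (g y - m) * D y) = fun y => (ssnmLR σ x d y * g y - ssnmLR σ x e y * g y)
      - m * (ssnmLR σ x d y - ssnmLR σ x e y) := by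
    ext y
    simp only [hD]
    ring
  have iX : Integrable (fun y => (g y - m) * D y) μ := by
    rw [eX]
    exact iG.sub iL
  have vX : ∫ y, (g y - m) * D y ∂μ = ssnmMean σ g (x + d) - ssnmMean σ g (x + e) := by
    rw [eX, integral_sub iG iL, integral_sub gd ge,
      integral_const_mul, integral_sub ld le, integral_ssnmLR hσ, integral_ssnmLR hσ,
      ssnmMean, ssnmMean, integral_ssnmP_add hσ, integral_ssnmP_add hσ]
    ring
  have iV : Integrable (fun y => (g y - m) ^ 2) μ := by
    have h : (fun y => (g y - m) ^ 2) = fun y => g y ^ 2 - 2 * m * g y + m ^ 2 := by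
      ext y
      ring
    rw [h]
    exact (hsq.sub (h0.const_mul _)).add (integrable_const _)
  have key : ∀ c : ℝ, 0 ≤ (∫ y, D y ^ 2 ∂μ) * (c * c)
      + (2 * ∫ y, (g y - m) * D y ∂μ) * c + ssnmVar σ g x := fun c => by
    have h : 0 ≤ ∫ y, (c ^ 2 * D y ^ 2 + 2 * c * ((g y - m) * D y) + (g y - m) ^ 2) ∂μ :=
      integral_nonneg fun y => by
        have : c ^ 2 * D y ^ 2 + 2 * c * ((g y - m) * D y) + (g y - m) ^ 2
          = (c * D y + (g y - m)) ^ 2 := by ring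
        simp only [this, Pi.zero_apply]
        positivity
    have iQ : Integrable (fun y => c ^ 2 * D y ^ 2 + 2 * c * ((g y - m) * D y)) μ :=
      (iD2.const_mul _).add (iX.const_mul _)
    rw [integral_add iQ iV,
      integral_add (iD2.const_mul _) (iX.const_mul _), integral_const_mul,
      integral_const_mul] at h
    rw [ssnmVar]
    linarith
  have hdisc := discrim_le_zero key
  rw [discrim, vX, vD2] at hdisc
  linarith

end Likelihood

/-- HCRB for the SSNM, full-sparsity case. If `S < N`,
`|supp(x₀)| = S`, `k ∉ supp(x₀)`, and `ĝ` is a finite-variance unbiased estimator of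
`x_k` on `X_S`, then `v(ĝ;x₀) ≥ σ² ((N−S−1)/(N−S)) exp(−ξ₀²/σ²)`, where
`ξ₀² = min_{l∈supp(x₀)} (x₀)_l²` (support given as the finset `K`). -/
theorem ssnm_hcrb_full {N S : ℕ} (hN : 1 ≤ N) (hS1 : 1 ≤ S) (hSN : S < N)
    (σ : ℝ) (hσ : 0 < σ) (k : Fin N)
    (x₀ : Fin N → ℝ)
    (K : Finset (Fin N)) (hK : ∀ l, l ∈ K ↔ x₀ l ≠ 0) (hKne : K.Nonempty)
    (hcard : (Function.support x₀).ncard = S) (hk : x₀ k = 0)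
    (g : (Fin N → ℝ) → ℝ) (hg : Measurable g)
    (hsq : Integrable (fun y => g y ^ 2) (ssnmP σ x₀))
    (hunb : ∀ x ∈ sparseSet N S,
      Integrable g (ssnmP σ x) ∧ (∫ y, g y ∂ ssnmP σ x) = x k) :
    σ ^ 2 * (((N : ℝ) - S - 1) / ((N : ℝ) - S)) *
        Real.exp (-(K.inf' hKne fun l => x₀ l ^ 2) / σ ^ 2)
      ≤ ssnmVar σ g x₀ := by
  have hM : (1 : ℝ) ≤ (N : ℝ) - S := by
    have : (S : ℝ) + 1 ≤ N := by exact_mod_cast hSN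
    linarith
  have hVnn : 0 ≤ ssnmVar σ g x₀ := integral_nonneg fun y => sq_nonneg _
  obtain ⟨l, hlK, hl⟩ := K.exists_mem_eq_inf' hKne fun l => x₀ l ^ 2
  rw [hl]
  have hxl : x₀ l ≠ 0 := (hK l).1 hlK
  have hlk : l ≠ k := fun h => hxl (h ▸ hk)
  set u : ℝ := 1 / ((N : ℝ) - S) with hu
  have hu0 : 0 < u := by positivity
  have hfac : ((N : ℝ) - S - 1) / ((N : ℝ) - S) = 1 - u := by
    rw [hu]
    field_simp
  rw [hfac]
  rcases hM.eq_or_lt with hM1 | hM1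
  · have : u = 1 := by rw [hu, ← hM1, div_one]
    simpa [this] using hVnn
  have hu1 : u < 1 := by
    rw [hu, div_lt_one (by linarith)]
    exact hM1
  set t : ℝ := σ * √u with ht
  have ht2 : t ^ 2 = σ ^ 2 * u := by rw [ht, mul_pow, Real.sq_sqrt hu0.le]
  set e : Fin N → ℝ := Pi.single l (-x₀ l) with he
  set d : Fin N → ℝ := Pi.single l (-x₀ l) + Pi.single k t with hd
  have hdd : ∑ i, d i * d i = x₀ l ^ 2 + t ^ 2 := by
    simp [hd, add_mul, mul_add, Finset.sum_add_distrib, Pi.single_apply, hlk, hlk.symm]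
    ring
  have hde : ∑ i, d i * e i = x₀ l ^ 2 := by
    simp [hd, he, add_mul, Pi.single_apply, hlk]
    ring
  have hee : ∑ i, e i * e i = x₀ l ^ 2 := by
    simp [he, Pi.single_apply]
    ring
  have hx0 : x₀ ∈ sparseSet N S := hcard.le
  have hxe : x₀ + e ∈ sparseSet N S := by
    refine (Set.ncard_le_ncard (t := Function.support x₀) (fun i hi => ?_)).trans hcard.le
    by_contra hi0
    have hi0 : x₀ i = 0 := by simpa using hi0
    have hil : i ≠ l := fun h => hxl (h ▸ hi0)
    simp [he, hi0, hil] at hi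
  have hxd : x₀ + d ∈ sparseSet N S := by
    have hsub : Function.support (x₀ + d) ⊆ insert k (Function.support x₀ \ {l}) := fun i hi => by
      by_cases hik : i = k
      · exact Or.inl hik
      refine Or.inr ⟨?_, ?_⟩
      · intro hi0
        have hil : i ≠ l := fun h => hxl (h ▸ hi0)
        simp [hd, hi0, hil, hik] at hi
      · rintro rfl
        simp [hd, hik] at hi
    refine (Set.ncard_le_ncard hsub).trans ((Set.ncard_insert_le _ _).trans ?_)
    have hlmem : l ∈ Function.support x₀ := hxl
    rw [Set.ncard_sdiff_singleton_add_one hlmem]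
    exact hcard.le
  have main := sq_sub_mean_le hσ x₀ d e hsq (hunb _ hx0).1 (hunb _ hxd).1 (hunb _ hxe).1
  have hmd : ssnmMean σ g (x₀ + d) = t := by
    rw [ssnmMean, (hunb _ hxd).2]
    simp [hd, hk, hlk.symm]
  have hme : ssnmMean σ g (x₀ + e) = 0 := by
    rw [ssnmMean, (hunb _ hxe).2]
    simp [he, hk, hlk.symm]
  have hexp : Real.exp ((x₀ l ^ 2 + t ^ 2) / σ ^ 2)
      = Real.exp (x₀ l ^ 2 / σ ^ 2) * Real.exp u := by
    rw [← Real.exp_add, ht2]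
    congr 1
    field_simp
  rw [hmd, hme, hdd, hde, hee, hexp, sub_zero, ht2] at main
  have h1u : 0 < 1 - u := by linarith
  have hu_exp : Real.exp u * (1 - u) ≤ 1 := by
    have h := mul_le_mul_of_nonneg_left (Real.one_sub_le_exp_neg u) (Real.exp_pos u).le
    rwa [← Real.exp_add, add_neg_cancel, Real.exp_zero] at h
  set A := Real.exp (x₀ l ^ 2 / σ ^ 2)
  have hA0 : 0 < A := Real.exp_pos _
  have hAinv : Real.exp (-x₀ l ^ 2 / σ ^ 2) = A⁻¹ := by rw [neg_div, Real.exp_neg]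
  rw [hAinv, ← div_eq_mul_inv, div_le_iff₀ hA0]
  have hVA : 0 ≤ ssnmVar σ g x₀ * A := by positivity
  have hfin : σ ^ 2 * (1 - u) * u ≤ ssnmVar σ g x₀ * A * u := by
    calc σ ^ 2 * (1 - u) * u = σ ^ 2 * u * (1 - u) := by ring
      _ ≤ ssnmVar σ g x₀ * (A * Real.exp u - 2 * A + A) * (1 - u) :=
          mul_le_mul_of_nonneg_right main h1u.le
      _ = ssnmVar σ g x₀ * A * (Real.exp u * (1 - u) - (1 - u)) := by ring
      _ ≤ ssnmVar σ g x₀ * A * u := mul_le_mul_of_nonneg_left (by linarith) hVA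
  exact le_of_mul_le_mul_right hfin hu0
end

section
/- (Lower semicontinuity of the minimum achievable variance.) Consider the SLGM and assume every set of at most S columns of H is linearly independent (spark(H) > S). Fix k ∈ {1,…,N}, let c : X_S → ℝ be continuous on X_S, and set γ(x) = c(x) + x_k. Assume that for every x₀ ∈ X_S there exists a Borel function ĝ : ℝ^M → ℝ with ∫ ĝ² dP_{x₀} < ∞ that is P_x-integrable with ∫ ĝ dP_x = γ(x) for every x ∈ X_S (i.e., the bias function c is valid at every x₀ ∈ X_S). Define, for x₀ ∈ X_S, M(x₀) = inf { v(ĝ; x₀) : ĝ : ℝ^M → ℝ Borel, ∫ ĝ² dP_{x₀} < ∞, and ĝ is P_x-integrable with ∫ ĝ dP_x = γ(x) for every x ∈ X_S }. Then the function x₀ ↦ M(x₀) is lower semicontinuous on X_S. -/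
open Matrix MeasureTheory ProbabilityTheory

/-- The distribution `P_x` of `y = Hx + n` where `n` has i.i.d. `N(0,σ²)` entries. -/
noncomputable def slgmP {M N : ℕ} (H : Matrix (Fin M) (Fin N) ℝ) (σ : ℝ)
    (x : Fin N → ℝ) : Measure (Fin M → ℝ) :=
  Measure.map (fun n => H.mulVec x + n)
    (Measure.pi fun _ : Fin M => gaussianReal 0 ((σ ^ 2).toNNReal))

/-- Mean function `γ_ĝ(x) = ∫ ĝ dP_x` of an estimator. -/
noncomputable def slgmMean {M N : ℕ} (H : Matrix (Fin M) (Fin N) ℝ) (σ : ℝ)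
    (g : (Fin M → ℝ) → ℝ) (x : Fin N → ℝ) : ℝ := ∫ y, g y ∂ slgmP H σ x

/-- Variance `v(ĝ;x) = ∫ (ĝ(y) − γ_ĝ(x))² dP_x(y)` of an estimator. -/
noncomputable def slgmVar {M N : ℕ} (H : Matrix (Fin M) (Fin N) ℝ) (σ : ℝ)
    (g : (Fin M → ℝ) → ℝ) (x : Fin N → ℝ) : ℝ :=
  ∫ y, (g y - slgmMean H σ g x) ^ 2 ∂ slgmP H σ x

open scoped RealInnerProductSpace NNReal ENNReal

section Hilbert

variable {E ι : Type*} [NormedAddCommGroup E] [InnerProductSpace ℝ E]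

/-- The concave quadratic form `a ↦ 2⟪∑ aᵢeᵢ, g⟫ - ‖∑ aᵢeᵢ‖²` expressed as a defect. -/
lemma two_mul_sum_inner_sub_gram (e : ι → E) (g : E) (s : Finset ι) (a : ι → ℝ) :
    2 * ∑ i ∈ s, a i * ⟪e i, g⟫ - ∑ i ∈ s, ∑ j ∈ s, a i * a j * ⟪e i, e j⟫
      = ‖g‖ ^ 2 - ‖g - ∑ i ∈ s, a i • e i‖ ^ 2 := by
  rw [norm_sub_sq_real, ← real_inner_self_eq_norm_sq (∑ i ∈ s, a i • e i), real_inner_comm,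
    sum_inner, sum_inner]
  simp only [inner_sum, real_inner_smul_left, real_inner_smul_right, mul_left_comm, mul_assoc]
  ring

/-- Projecting onto the closed span of a family keeps the inner products with the family and
makes the squared norm approximable by the associated quadratic forms. -/
lemma exists_inner_eq_and_norm_sq_approx [CompleteSpace E] (e : ι → E) (g : E) :
    ∃ p : E, (∀ i, ⟪e i, p⟫ = ⟪e i, g⟫) ∧ ∀ r < ‖p‖ ^ 2, ∃ (s : Finset ι) (a : ι → ℝ),
      r < 2 * ∑ i ∈ s, a i * ⟪e i, g⟫ - ∑ i ∈ s, ∑ j ∈ s, a i * a j * ⟪e i, e j⟫ := by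
  set U := (Submodule.span ℝ (Set.range e)).topologicalClosure
  have hcl : IsClosed (U : Set E) := Submodule.isClosed_topologicalClosure _
  have : CompleteSpace U := hcl.completeSpace_coe
  have hU (i : ι) : e i ∈ U :=
    Submodule.le_topologicalClosure _ (Submodule.subset_span (Set.mem_range_self i))
  have hp (i : ι) : ⟪e i, U.starProjection g⟫ = ⟪e i, g⟫ := by
    rw [← Submodule.inner_starProjection_left_eq_right,
      Submodule.starProjection_eq_self_iff.2 (hU i)]
  refine ⟨U.starProjection g, hp, fun r hr => ?_⟩
  have hmem : U.starProjection g ∈ closure (Submodule.span ℝ (Set.range e) : Set E) := by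
    rw [← Submodule.topologicalClosure_coe]
    exact Submodule.starProjection_apply_mem U g
  obtain ⟨u, hu, hpu⟩ := Metric.mem_closure_iff.1 hmem _ (Real.sqrt_pos.2 (sub_pos.2 hr))
  obtain ⟨c, rfl⟩ := Finsupp.mem_span_range_iff_exists_finsupp.1 hu
  refine ⟨c.support, c, ?_⟩
  simp only [← hp]
  rw [two_mul_sum_inner_sub_gram]
  rw [dist_eq_norm, Real.lt_sqrt (norm_nonneg _), Finsupp.sum] at hpu
  linarith

end Hilbert

section GaussianShift

variable {ι : Type*} [Fintype ι]

/-- The centred product Gaussian measure with variance `v` in every coordinate. -/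
noncomputable abbrev piGaussian (ι : Type*) [Fintype ι] (v : ℝ≥0) : Measure (ι → ℝ) :=
  Measure.pi fun _ => gaussianReal 0 v

/-- The Cameron–Martin density of the shift by `b` of the centred product Gaussian measure. -/
noncomputable def shiftDensity (v : ℝ≥0) (b z : ι → ℝ) : ℝ :=
  Real.exp ((b ⬝ᵥ z) / v - (b ⬝ᵥ b) / (2 * v))

@[fun_prop]
lemma continuous_shiftDensity (v : ℝ≥0) (b : ι → ℝ) : Continuous (shiftDensity v b) := by
  unfold shiftDensity dotProduct
  fun_prop

lemma shiftDensity_pos (v : ℝ≥0) (b z : ι → ℝ) : 0 < shiftDensity v b z := Real.exp_pos _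

lemma lintegral_piGaussian_prod (v : ℝ≥0) {f : ι → ℝ → ℝ≥0∞} (hf : ∀ i, Measurable (f i)) :
    ∫⁻ z, ∏ i, f i (z i) ∂piGaussian ι v = ∏ i, ∫⁻ t, f i t ∂gaussianReal 0 v := by
  refine (lintegral_prod_eq_prod_lintegral_of_indepFun Finset.univ
    (fun i (z : ι → ℝ) => f i (z i))
    (iIndepFun_pi fun i => (hf i).aemeasurable)
    fun i => (hf i).comp (measurable_pi_apply i)).trans ?_
  refine Finset.prod_congr rfl fun i _ => ?_
  exact (measurePreserving_eval (fun _ : ι => gaussianReal 0 v) i).lintegral_comp (hf i)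

lemma gaussianReal_eq_withDensity_gaussianReal_zero {v : ℝ≥0} (hv : v ≠ 0) (b : ℝ) :
    gaussianReal b v = (gaussianReal 0 v).withDensity
      fun t => ENNReal.ofReal (Real.exp (b * t / v - b * b / (2 * v))) := by
  rw [gaussianReal_of_var_ne_zero _ hv, gaussianReal_of_var_ne_zero _ hv,
    ← withDensity_mul _ (by fun_prop) (by fun_prop)]
  congr 1
  ext t
  have hv' : (v : ℝ) ≠ 0 := by exact_mod_cast hv
  rw [Pi.mul_apply, gaussianPDF, gaussianPDF, ← ENNReal.ofReal_mul (gaussianPDFReal_nonneg _ _ _),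
    gaussianPDFReal, gaussianPDFReal, mul_assoc (√_)⁻¹, ← Real.exp_add]
  congr 3
  field_simp
  ring

/-- The Cameron–Martin formula for finite products of centred Gaussian measures. -/
lemma map_add_piGaussian {v : ℝ≥0} (hv : v ≠ 0) (b : ι → ℝ) :
    (piGaussian ι v).map (fun z => b + z)
      = (piGaussian ι v).withDensity fun z => ENNReal.ofReal (shiftDensity v b z) := by
  have hmap : (piGaussian ι v).map (fun z => b + z) = Measure.pi fun i => gaussianReal (b i) v := by
    have hb (i : ι) : (gaussianReal 0 v).map (b i + ·) = gaussianReal (b i) v := by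
      rw [gaussianReal_map_const_add, zero_add]
    have (i : ι) : SigmaFinite ((gaussianReal 0 v).map (b i + ·)) := by
      rw [hb]; infer_instance
    simp only [← hb]
    exact Measure.pi_map_pi fun i => (measurable_const_add (b i)).aemeasurable
  rw [hmap]
  refine Measure.pi_eq fun s hs => ?_
  rw [withDensity_apply _ (MeasurableSet.univ_pi hs),
    ← lintegral_indicator (MeasurableSet.univ_pi hs)]
  simp_rw [gaussianReal_eq_withDensity_gaussianReal_zero hv (b _), withDensity_apply _ (hs _),
    ← lintegral_indicator (hs _)]
  rw [← lintegral_piGaussian_prod v fun i => Measurable.indicator (by fun_prop) (hs i)]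
  congr 1
  ext z
  by_cases hz : z ∈ Set.univ.pi s
  · rw [Set.indicator_of_mem hz]
    simp only [Set.mem_univ_pi] at hz
    simp_rw [Set.indicator_of_mem (hz _)]
    rw [← ENNReal.ofReal_prod_of_nonneg fun _ _ => (Real.exp_pos _).le, ← Real.exp_sum,
      Finset.sum_sub_distrib, ← Finset.sum_div, ← Finset.sum_div]
    rfl
  · rw [Set.indicator_of_notMem hz]
    simp only [Set.mem_univ_pi, not_forall] at hz
    obtain ⟨i, hi⟩ := hz
    exact (Finset.prod_eq_zero (Finset.mem_univ i) (Set.indicator_of_notMem hi _)).symm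

lemma integral_comp_add_piGaussian {v : ℝ≥0} (hv : v ≠ 0) (b : ι → ℝ) {f : (ι → ℝ) → ℝ}
    (hf : Measurable f) :
    ∫ z, f (b + z) ∂piGaussian ι v = ∫ z, shiftDensity v b z * f z ∂piGaussian ι v := by
  rw [← integral_map (φ := fun z => b + z) (by fun_prop) hf.aestronglyMeasurable,
    map_add_piGaussian hv,
    integral_withDensity_eq_integral_toReal_smul (by fun_prop) (by simp)]
  simp [ENNReal.toReal_ofReal (shiftDensity_pos v b _).le]

lemma integrable_comp_add_piGaussian_iff {v : ℝ≥0} (hv : v ≠ 0) (b : ι → ℝ) {f : (ι → ℝ) → ℝ}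
    (hf : Measurable f) :
    Integrable (fun z => f (b + z)) (piGaussian ι v)
      ↔ Integrable (fun z => shiftDensity v b z * f z) (piGaussian ι v) := by
  have := integrable_map_measure (μ := piGaussian ι v) (f := fun z => b + z) (g := f)
    hf.aestronglyMeasurable (by fun_prop)
  rw [Function.comp_def] at this
  rw [← this, map_add_piGaussian hv,
    integrable_withDensity_iff_integrable_smul' (by fun_prop) (by simp)]
  simp [ENNReal.toReal_ofReal (shiftDensity_pos v b _).le]

lemma integrable_shiftDensity {v : ℝ≥0} (hv : v ≠ 0) (b : ι → ℝ) :
    Integrable (shiftDensity v b) (piGaussian ι v) := by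
  simpa using (integrable_comp_add_piGaussian_iff hv b (f := fun _ => 1) measurable_const).1
    (integrable_const 1)

lemma integral_shiftDensity {v : ℝ≥0} (hv : v ≠ 0) (b : ι → ℝ) :
    ∫ z, shiftDensity v b z ∂piGaussian ι v = 1 := by
  simpa using (integral_comp_add_piGaussian hv b (f := fun _ => 1) measurable_const).symm

lemma shiftDensity_mul (v : ℝ≥0) (b b' z : ι → ℝ) :
    shiftDensity v b z * shiftDensity v b' z
      = Real.exp ((b ⬝ᵥ b') / v) * shiftDensity v (b + b') z := by
  simp only [shiftDensity, ← Real.exp_add, add_dotProduct, dotProduct_add]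
  rw [dotProduct_comm b' b]
  congr 1
  rcases eq_or_ne (v : ℝ) 0 with hv | hv
  · simp [hv]
  · field_simp
    ring

lemma memLp_shiftDensity {v : ℝ≥0} (hv : v ≠ 0) (b : ι → ℝ) :
    MemLp (shiftDensity v b) 2 (piGaussian ι v) := by
  rw [memLp_two_iff_integrable_sq (by fun_prop)]
  simp only [pow_two, shiftDensity_mul]
  exact (integrable_shiftDensity hv _).const_mul _

lemma inner_toLp_two {Ω : Type*} [MeasurableSpace Ω] {μ : Measure Ω} {f g : Ω → ℝ}
    (hf : MemLp f 2 μ) (hg : MemLp g 2 μ) : ⟪hf.toLp f, hg.toLp g⟫ = ∫ z, f z * g z ∂μ := by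
  rw [L2.inner_def]
  refine integral_congr_ae ?_
  filter_upwards [hf.coeFn_toLp, hg.coeFn_toLp] with z h₁ h₂
  rw [h₁, h₂, real_inner_eq_re_inner]
  simp [mul_comm]

/-- The Cameron–Martin density as an element of `L²`. -/
noncomputable def shiftLp {v : ℝ≥0} (hv : v ≠ 0) (b : ι → ℝ) : Lp ℝ 2 (piGaussian ι v) :=
  (memLp_shiftDensity hv b).toLp _

lemma inner_shiftLp_shiftLp {v : ℝ≥0} (hv : v ≠ 0) (b b' : ι → ℝ) :
    ⟪shiftLp hv b, shiftLp hv b'⟫ = Real.exp ((b ⬝ᵥ b') / v) := by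
  rw [shiftLp, shiftLp, inner_toLp_two]
  simp only [shiftDensity_mul]
  rw [integral_const_mul, integral_shiftDensity hv, mul_one]

lemma inner_shiftLp_toLp {v : ℝ≥0} (hv : v ≠ 0) (b : ι → ℝ) {f : (ι → ℝ) → ℝ}
    (hf : Measurable f) (hf' : MemLp f 2 (piGaussian ι v)) :
    ⟪shiftLp hv b, hf'.toLp f⟫ = ∫ z, f (b + z) ∂piGaussian ι v := by
  rw [shiftLp, inner_toLp_two, integral_comp_add_piGaussian hv b hf]

lemma integrable_comp_add_piGaussian {v : ℝ≥0} (hv : v ≠ 0) (b : ι → ℝ) {f : (ι → ℝ) → ℝ}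
    (hf : Measurable f) (hf' : MemLp f 2 (piGaussian ι v)) :
    Integrable (fun z => f (b + z)) (piGaussian ι v) :=
  (integrable_comp_add_piGaussian_iff hv b hf).2 ((memLp_shiftDensity hv b).integrable_mul hf')

end GaussianShift

section SLGM

variable {M N : ℕ} (H : Matrix (Fin M) (Fin N) ℝ) (σ : ℝ)

lemma integral_slgmP {g : (Fin M → ℝ) → ℝ} (hg : Measurable g) (x : Fin N → ℝ) :
    ∫ y, g y ∂slgmP H σ x = ∫ z, g (H *ᵥ x + z) ∂piGaussian (Fin M) (σ ^ 2).toNNReal :=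
  integral_map (by fun_prop) hg.aestronglyMeasurable

lemma integrable_slgmP_iff {g : (Fin M → ℝ) → ℝ} (hg : Measurable g) (x : Fin N → ℝ) :
    Integrable g (slgmP H σ x)
      ↔ Integrable (fun z => g (H *ᵥ x + z)) (piGaussian (Fin M) (σ ^ 2).toNNReal) :=
  integrable_map_measure hg.aestronglyMeasurable (by fun_prop)

instance (x : Fin N → ℝ) : IsProbabilityMeasure (slgmP H σ x) :=
  Measure.isProbabilityMeasure_map (by fun_prop)

lemma slgmVar_eq_sub {g : (Fin M → ℝ) → ℝ} (hg : Measurable g) {x : Fin N → ℝ}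
    (hg2 : Integrable (fun y => g y ^ 2) (slgmP H σ x)) :
    slgmVar H σ g x = ∫ y, g y ^ 2 ∂slgmP H σ x - slgmMean H σ g x ^ 2 := by
  have h := variance_eq_sub ((memLp_two_iff_integrable_sq hg.aestronglyMeasurable).2 hg2)
  rw [variance_eq_integral hg.aemeasurable] at h
  exact h

variable {σ} (hv : (σ ^ 2).toNNReal ≠ 0)

lemma memLp_comp_add_of_integrable_sq {g : (Fin M → ℝ) → ℝ} (hg : Measurable g) {x : Fin N → ℝ}
    (hg2 : Integrable (fun y => g y ^ 2) (slgmP H σ x)) :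
    MemLp (fun z => g (H *ᵥ x + z)) 2 (piGaussian (Fin M) (σ ^ 2).toNNReal) :=
  (memLp_two_iff_integrable_sq
    (hg.comp (measurable_const_add _)).aestronglyMeasurable).2
    ((integrable_slgmP_iff H σ (hg.pow_const 2) x).1 hg2)

/-- The likelihood ratio of the observation laws at `x` and `x₀`, in coordinates centred at
`x₀`. -/
noncomputable def slgmLikelihood (x₀ x : Fin N → ℝ) :
    Lp ℝ 2 (piGaussian (Fin M) (σ ^ 2).toNNReal) :=
  shiftLp hv (H *ᵥ (x - x₀))

lemma inner_slgmLikelihood {g : (Fin M → ℝ) → ℝ} (hg : Measurable g) {x₀ : Fin N → ℝ}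
    (hg2 : Integrable (fun y => g y ^ 2) (slgmP H σ x₀)) (x : Fin N → ℝ) :
    ⟪slgmLikelihood H hv x₀ x, (memLp_comp_add_of_integrable_sq H hg hg2).toLp _⟫
      = ∫ y, g y ∂slgmP H σ x := by
  rw [slgmLikelihood, inner_shiftLp_toLp hv _ (by fun_prop), integral_slgmP H σ hg]
  simp [← add_assoc, ← mulVec_add]

lemma norm_sq_toLp_comp_add {g : (Fin M → ℝ) → ℝ} (hg : Measurable g) {x₀ : Fin N → ℝ}
    (hg2 : Integrable (fun y => g y ^ 2) (slgmP H σ x₀)) :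
    ‖(memLp_comp_add_of_integrable_sq H hg hg2).toLp _‖ ^ 2 = ∫ y, g y ^ 2 ∂slgmP H σ x₀ := by
  rw [← real_inner_self_eq_norm_sq, inner_toLp_two, integral_slgmP H σ (hg.pow_const 2)]
  simp only [pow_two]

lemma continuous_inner_slgmLikelihood (x x' : Fin N → ℝ) :
    Continuous fun x₀ => ⟪slgmLikelihood H hv x₀ x, slgmLikelihood H hv x₀ x'⟫ := by
  simp only [slgmLikelihood, inner_shiftLp_shiftLp]
  unfold dotProduct mulVec dotProduct
  fun_prop

/-- Every element of `L²` is realised by an estimator with finite second moment at `x₀`. -/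
lemma exists_estimator (x₀ : Fin N → ℝ) (p : Lp ℝ 2 (piGaussian (Fin M) (σ ^ 2).toNNReal)) :
    ∃ g : (Fin M → ℝ) → ℝ, Measurable g ∧ Integrable (fun y => g y ^ 2) (slgmP H σ x₀) ∧
      (∀ x, Integrable g (slgmP H σ x) ∧
        ∫ y, g y ∂slgmP H σ x = ⟪slgmLikelihood H hv x₀ x, p⟫) ∧
      ∫ y, g y ^ 2 ∂slgmP H σ x₀ = ‖p‖ ^ 2 := by
  obtain ⟨f, hf, hpf⟩ : ∃ f : (Fin M → ℝ) → ℝ, Measurable f ∧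
      p =ᵐ[piGaussian (Fin M) (σ ^ 2).toNNReal] f :=
    ⟨_, (Lp.aestronglyMeasurable p).stronglyMeasurable_mk.measurable,
      (Lp.aestronglyMeasurable p).ae_eq_mk⟩
  have hf2 : MemLp f 2 (piGaussian (Fin M) (σ ^ 2).toNNReal) :=
    (memLp_congr_ae hpf).1 (Lp.memLp p)
  have hp : p = hf2.toLp f := by
    rw [← Lp.toLp_coeFn p (Lp.memLp p)]
    exact MemLp.toLp_congr _ _ hpf
  have hg : Measurable fun y => f (y - H *ᵥ x₀) := by fun_prop
  have hg2 : Integrable (fun y => f (y - H *ᵥ x₀) ^ 2) (slgmP H σ x₀) := by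
    rw [integrable_slgmP_iff H σ (hg.pow_const 2)]
    simpa using hf2.integrable_sq
  have hgp : (memLp_comp_add_of_integrable_sq H hg hg2).toLp _ = p := by
    rw [hp]
    congr 1
    simp
  refine ⟨_, hg, hg2, fun x => ⟨?_, ?_⟩, ?_⟩
  · rw [integrable_slgmP_iff H σ hg]
    convert integrable_comp_add_piGaussian hv (H *ᵥ (x - x₀)) hf hf2 using 3
    rw [mulVec_sub]
    abel
  · rw [← inner_slgmLikelihood H hv hg hg2, hgp]
  · rw [← norm_sq_toLp_comp_add H hg hg2, hgp]

end SLGM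

/-- Lower semicontinuity of the minimum achievable variance. For
the SLGM with `spark(H) > S`, parameter function `g(x) = x_k`, and a continuous
prescribed bias function `c` (so prescribed mean `γ(x) = c(x) + x_k`) that is valid at
every `x₀ ∈ X_S`, the minimum achievable variance
`M(x₀) = inf { v(ĝ;x₀) : ĝ has mean γ on X_S and finite variance at x₀ }`
is a lower semicontinuous function of `x₀` on `X_S`. -/
theorem slgm_min_variance_lowerSemicontinuousOn {N M S : ℕ} (hN : 1 ≤ N) (hM : 1 ≤ M)
    (hS1 : 1 ≤ S) (hSN : S ≤ N)
    (H : Matrix (Fin M) (Fin N) ℝ) (σ : ℝ) (hσ : 0 < σ)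
    (hspark : ∀ K : Finset (Fin N), K.card ≤ S →
      LinearIndependent ℝ (fun k : ↥K => fun m => H m k.1))
    (k : Fin N)
    (c : (Fin N → ℝ) → ℝ) (hc : ContinuousOn c (sparseSet N S))
    (hvalid : ∀ x₀ ∈ sparseSet N S, ∃ g : (Fin M → ℝ) → ℝ, Measurable g ∧
      Integrable (fun y => g y ^ 2) (slgmP H σ x₀) ∧
      ∀ x ∈ sparseSet N S,
        Integrable g (slgmP H σ x) ∧ (∫ y, g y ∂ slgmP H σ x) = c x + x k) :
    LowerSemicontinuousOn
      (fun x₀ : Fin N → ℝ =>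
        sInf {v : ℝ | ∃ g : (Fin M → ℝ) → ℝ, Measurable g ∧
          Integrable (fun y => g y ^ 2) (slgmP H σ x₀) ∧
          (∀ x ∈ sparseSet N S,
            Integrable g (slgmP H σ x) ∧ (∫ y, g y ∂ slgmP H σ x) = c x + x k) ∧
          v = slgmVar H σ g x₀})
      (sparseSet N S) := by
  have hv : (σ ^ 2).toNNReal ≠ 0 := (Real.toNNReal_pos.2 (by positivity)).ne'
  intro x₀ hx₀ r hr
  obtain ⟨g₀, hg₀, hg₀2, hmean₀⟩ := hvalid x₀ hx₀
  obtain ⟨p, hp, happrox⟩ := exists_inner_eq_and_norm_sq_approx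
    (fun x : sparseSet N S => slgmLikelihood H hv x₀ x)
    ((memLp_comp_add_of_integrable_sq H hg₀ hg₀2).toLp _)
  obtain ⟨g, hg, hg2, hgmean, hgsq⟩ := exists_estimator H hv x₀ p
  have hgvalid (x : Fin N → ℝ) (hx : x ∈ sparseSet N S) :
      Integrable g (slgmP H σ x) ∧ (∫ y, g y ∂slgmP H σ x) = c x + x k := by
    refine ⟨(hgmean x).1, ?_⟩
    rw [(hgmean x).2, hp ⟨x, hx⟩, inner_slgmLikelihood H hv hg₀ hg₀2, (hmean₀ x hx).2]
  have hle : r < ‖p‖ ^ 2 - (c x₀ + x₀ k) ^ 2 := by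
    refine hr.trans_le (csInf_le ⟨0, ?_⟩ ⟨g, hg, hg2, hgvalid, ?_⟩)
    · rintro _ ⟨f, -, -, -, rfl⟩
      exact integral_nonneg fun _ => sq_nonneg _
    · rw [slgmVar_eq_sub H σ hg hg2, hgsq, slgmMean, (hgvalid x₀ hx₀).2]
  obtain ⟨s, a, hsa⟩ := happrox (r + (c x₀ + x₀ k) ^ 2) (by linarith)
  simp only [inner_slgmLikelihood H hv hg₀ hg₀2, (hmean₀ _ (Subtype.prop _)).2] at hsa
  set F : (Fin N → ℝ) → ℝ := fun x₁ =>
    2 * ∑ i ∈ s, a i * (c i + i.1 k) - ∑ i ∈ s, ∑ j ∈ s, a i * a j *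
      ⟪slgmLikelihood H hv x₁ i, slgmLikelihood H hv x₁ j⟫ - (c x₁ + x₁ k) ^ 2 with hF
  have hFcont : ContinuousOn F (sparseSet N S) := by
    have h₁ : Continuous fun x₁ => ∑ i ∈ s, ∑ j ∈ s, a i * a j *
        ⟪slgmLikelihood H hv x₁ (i : Fin N → ℝ), slgmLikelihood H hv x₁ (j : Fin N → ℝ)⟫ :=
      continuous_finsetSum _ fun i _ => continuous_finsetSum _ fun j _ =>
        continuous_const.mul (continuous_inner_slgmLikelihood H hv i j)
    exact (continuousOn_const.sub h₁.continuousOn).sub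
      ((hc.add (continuous_apply k).continuousOn).pow 2)
  have hFx₀ : r < F x₀ := by
    rw [hF]
    linarith
  filter_upwards [(hFcont x₀ hx₀).eventually_const_lt hFx₀, self_mem_nhdsWithin] with x₁ hrx hx₁
  obtain ⟨g₁, hg₁, hg₁2, hmean₁⟩ := hvalid x₁ hx₁
  refine hrx.trans_le (le_csInf ⟨_, g₁, hg₁, hg₁2, hmean₁, rfl⟩ ?_)
  rintro _ ⟨f, hf, hf2, hfmean, rfl⟩
  rw [slgmVar_eq_sub H σ hf hf2, slgmMean, (hfmean x₁ hx₁).2]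
  have h := two_mul_sum_inner_sub_gram (fun x : sparseSet N S => slgmLikelihood H hv x₁ x)
    ((memLp_comp_add_of_integrable_sq H hf hf2).toLp _) s a
  simp only [inner_slgmLikelihood H hv hf hf2, (hfmean _ (Subtype.prop _)).2,
    norm_sq_toLp_comp_add H hf hf2] at h
  refine sub_le_sub_right (h.trans_le ?_) _
  exact sub_le_self _ (sq_nonneg (‖_‖ : ℝ))
end
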